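/- Let G be a digraph rooted at v, let u ∈ V with D = dom_G(u), and let A be an arborescence of G rooted at v. Then the unique edge of A entering u has its tail outside D; i.e., A cannot use any edge into u whose tail lies in D∖{u}. -/

import Mathlib

open MvPolynomial

/-- A finite directed (multi)graph with abstractly named edges: a finite set of
vertices, a finite set of edge names, and source/target maps.  Edge names double
as the labels/variables of the Kirchhoff polynomial. -/
structure MultiDigraph (V : Type*) (ε : Type*) where
  verts : Finset V
  edges : Finset ε
  src : ε → V
  tgt : ε → V

namespace MultiDigraph

variable {V : Type*} {ε : Type*} [DecidableEq V] [DecidableEq ε]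

/-- One step along an edge of `A`. -/
def Step (G : MultiDigraph V ε) (A : Finset ε) (x y : V) : Prop :=
  ∃ e ∈ A, G.src e = x ∧ G.tgt e = y

/-- Directed reachability using only edges of `A`. -/
def Reaches (G : MultiDigraph V ε) (A : Finset ε) (x y : V) : Prop :=
  Relation.ReflTransGen (G.Step A) x y

/-- Every edge has both of its endpoints among the vertices. -/
def WellFormed (G : MultiDigraph V ε) : Prop :=
  ∀ e ∈ G.edges, G.src e ∈ G.verts ∧ G.tgt e ∈ G.verts

/-- `G` is a simple digraph: it has no loops and no parallel edges. -/
def Simple (G : MultiDigraph V ε) : Prop :=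
  (∀ e ∈ G.edges, G.src e ≠ G.tgt e) ∧
    ∀ e ∈ G.edges, ∀ e' ∈ G.edges, G.src e = G.src e' → G.tgt e = G.tgt e' → e = e'

/-- `A` is (the edge set of) an arborescence of `G` rooted at `r`: a spanning
subdigraph in which every vertex other than the root has exactly one incoming
edge, the root has none, and every vertex is reachable from the root (hence
along a unique directed path). -/
def IsArbAt (G : MultiDigraph V ε) (A : Finset ε) (r : V) : Prop :=
  A ⊆ G.edges ∧ r ∈ G.verts ∧
  (∀ e ∈ A, G.src e ∈ G.verts ∧ G.tgt e ∈ G.verts) ∧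
  (∀ e ∈ A, G.tgt e ≠ r) ∧
  (∀ w ∈ G.verts, w ≠ r → ∃! e, e ∈ A ∧ G.tgt e = w) ∧
  (∀ w ∈ G.verts, G.Reaches A r w)

/-- `A` is an arborescence of `G` (rooted at some vertex). -/
def IsArb (G : MultiDigraph V ε) (A : Finset ε) : Prop :=
  ∃ r, G.IsArbAt A r

open Classical in
/-- The Kirchhoff polynomial of `G`: the sum, over all arborescences, of the
products of the variables of their edges. -/
noncomputable def kirchhoff (G : MultiDigraph V ε) : MvPolynomial ε ℚ :=
  ∑ A ∈ G.edges.powerset.filter (fun A => G.IsArb A), ∏ e ∈ A, X e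

open Classical in
/-- The Kirchhoff polynomial of arborescences of `G` rooted at `r`. -/
noncomputable def kirchhoffAt (G : MultiDigraph V ε) (r : V) : MvPolynomial ε ℚ :=
  ∑ A ∈ G.edges.powerset.filter (fun A => G.IsArbAt A r), ∏ e ∈ A, X e

/-- The incoming edges of vertex `v`. -/
def inEdges (G : MultiDigraph V ε) (v : V) : Finset ε :=
  G.edges.filter (fun e => G.tgt e = v)

/-- `G` is rooted at `v`: `v` has no incoming edges and every vertex is
reachable from `v`. -/
def RootedAt (G : MultiDigraph V ε) (v : V) : Prop :=
  v ∈ G.verts ∧ (∀ e ∈ G.edges, G.tgt e ≠ v) ∧ ∀ w ∈ G.verts, G.Reaches G.edges v w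

/-- `G` is strongly connected. -/
def StronglyConnected (G : MultiDigraph V ε) : Prop :=
  ∀ x ∈ G.verts, ∀ y ∈ G.verts, G.Reaches G.edges x y

/-- `G` is (weakly) connected. -/
def WeaklyConnected (G : MultiDigraph V ε) : Prop :=
  ∀ x ∈ G.verts, ∀ y ∈ G.verts,
    Relation.ReflTransGen (fun a b => G.Step G.edges a b ∨ G.Step G.edges b a) x y

/-- The induced subdigraph `G[D]`. -/
def induce (G : MultiDigraph V ε) (D : Finset V) : MultiDigraph V ε where
  verts := D
  edges := G.edges.filter (fun e => G.src e ∈ D ∧ G.tgt e ∈ D)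
  src := G.src
  tgt := G.tgt

/-- `root_u(G)`: remove all edges incoming to `u`. -/
def rootAt (G : MultiDigraph V ε) (u : V) : MultiDigraph V ε where
  verts := G.verts
  edges := G.edges.filter (fun e => G.tgt e ≠ u)
  src := G.src
  tgt := G.tgt

/-- Delete a single edge. -/
def deleteEdge (G : MultiDigraph V ε) (e₀ : ε) : MultiDigraph V ε where
  verts := G.verts
  edges := G.edges.erase e₀
  src := G.src
  tgt := G.tgt

/-- The contraction `G(S → u)`: all edges from `Vᶜ∖S` into `S∖{u}` and all edges
inside `S` are removed, and `S` is contracted into the single vertex `u`;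
edges retain their names (labels). -/
def contract (G : MultiDigraph V ε) (S : Finset V) (u : V) : MultiDigraph V ε where
  verts := insert u (G.verts \ S)
  edges := G.edges.filter (fun e => G.tgt e ∉ S ∨ (G.src e ∉ S ∧ G.tgt e = u))
  src := fun e => if G.src e ∈ S then u else G.src e
  tgt := fun e => if G.tgt e ∈ S then u else G.tgt e

/-- Directed walks from `x` to `y`, given as lists of edges taken from `A`. -/
def IsWalk (G : MultiDigraph V ε) (A : Finset ε) : List ε → V → V → Prop
  | [], x, y => x = y
  | e :: p, x, y => e ∈ A ∧ G.src e = x ∧ IsWalk G A p (G.tgt e) y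

/-- A simple directed path from `x` to `y` (no repeated vertices). -/
def IsPath (G : MultiDigraph V ε) (A : Finset ε) (p : List ε) (x y : V) : Prop :=
  G.IsWalk A p x y ∧ (x :: p.map G.tgt).Nodup

/-- A simple directed cycle through `x` (no repeated vertices). -/
def IsCycle (G : MultiDigraph V ε) (A : Finset ε) (p : List ε) (x : V) : Prop :=
  p ≠ [] ∧ G.IsWalk A p x x ∧ (p.map G.tgt).Nodup

/-- The edge set `A` contains no directed cycle. -/
def Acyclic (G : MultiDigraph V ε) (A : Finset ε) : Prop :=
  ¬ ∃ p x, G.IsCycle A p x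

/-- In `G` rooted at `v`, vertex `u` dominates vertex `w`: every directed path
from `v` to `w` passes through `u`. -/
def Dominates (G : MultiDigraph V ε) (v u w : V) : Prop :=
  ∀ p : List ε, G.IsPath G.edges p v w → u ∈ v :: p.map G.tgt

open Classical in
/-- `dom_G(u)` (w.r.t. the root `v`): the set of all vertices dominated by `u`. -/
noncomputable def domSet (G : MultiDigraph V ε) (v u : V) : Finset V :=
  G.verts.filter (fun w => G.Dominates v u w)

/-- In `G` rooted at `v`, `y` is an immediate dominator of `z`. -/
def ImmDominates (G : MultiDigraph V ε) (v y z : V) : Prop :=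
  y ≠ z ∧ G.Dominates v y z ∧
    ∀ x ∈ G.verts, x ≠ y → x ≠ z → G.Dominates v x z → G.Dominates v x y

open Classical in
/-- `imm_G(y)` (w.r.t. the root `v`): the set of vertices immediately dominated by `y`. -/
noncomputable def immSet (G : MultiDigraph V ε) (v y : V) : Finset V :=
  G.verts.filter (fun z => G.ImmDominates v y z)

open Classical in
/-- The simultaneous contraction `G(dom(z₁) → z₁; …; dom(z_i) → z_i)` for
`Z = {z₁, …, z_i}` (domination w.r.t. the root `v`). -/
noncomputable def domContract (G : MultiDigraph V ε) (v : V) (Z : Finset V) :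
    MultiDigraph V ε where
  verts := G.verts.filter (fun x => ∀ z ∈ Z, G.Dominates v z x → x = z)
  edges := G.edges.filter (fun e =>
    (∀ z ∈ Z, ¬(G.Dominates v z (G.src e) ∧ G.Dominates v z (G.tgt e))) ∧
    (∀ z ∈ Z, ¬(¬ G.Dominates v z (G.src e) ∧ G.Dominates v z (G.tgt e) ∧ G.tgt e ≠ z)))
  src := fun e =>
    if h : ∃ z ∈ Z, G.Dominates v z (G.src e) ∧ G.src e ≠ z then h.choose else G.src e
  tgt := fun e =>
    if h : ∃ z ∈ Z, G.Dominates v z (G.tgt e) ∧ G.tgt e ≠ z then h.choose else G.tgt e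

/-- Mutual directed reachability in `G`. -/
def MutuallyReachable (G : MultiDigraph V ε) (x y : V) : Prop :=
  G.Reaches G.edges x y ∧ G.Reaches G.edges y x

open Classical in
/-- `W` is (the vertex set of) a strongly connected component of `G`, i.e. an
equivalence class of mutual reachability. -/
def IsSCC (G : MultiDigraph V ε) (W : Finset V) : Prop :=
  ∃ x ∈ G.verts, W = G.verts.filter (fun y => G.MutuallyReachable x y)

/-- `W` is a minimal element in the partial order that reachability induces on
the strongly connected components of `G` (an initial SCC). -/
def IsMinimalSCC (G : MultiDigraph V ε) (W : Finset V) : Prop :=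
  G.IsSCC W ∧ ∀ W', G.IsSCC W' → (∃ x ∈ W', ∃ y ∈ W, G.Reaches G.edges x y) → W' = W

open Classical in
/-- The digraph `Ĝ(W)` associated with a strongly connected component `G[W]`:
if `G[W]` has no incoming edges (it is the initial SCC) it is `G[W]` itself;
otherwise a new auxiliary vertex (here `none`) is added and every edge of `G`
entering `W` from outside is redirected to start at the auxiliary vertex,
keeping its label. -/
noncomputable def hatSCC (G : MultiDigraph V ε) (W : Finset V) :
    MultiDigraph (Option V) ε where
  verts :=
    if ∃ e ∈ G.edges, G.tgt e ∈ W ∧ G.src e ∉ W then insert none (W.image some)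
    else W.image some
  edges := G.edges.filter (fun e => G.tgt e ∈ W)
  src := fun e => if G.src e ∈ W then some (G.src e) else none
  tgt := fun e => some (G.tgt e)

/-- `u` is an independent vertex of the simple directed cycle `C` (w.r.t. the
root `v`): `u` lies on `C` and there is a simple directed path from `v` to `u`
which is vertex-disjoint from `C` except at `u`. -/
def IsIndependentVertex (G : MultiDigraph V ε) (v : V) (C : List ε) (u : V) : Prop :=
  u ∈ C.map G.tgt ∧ ∃ p, G.IsPath G.edges p v u ∧
    ∀ z ∈ v :: p.map G.tgt, z ∈ C.map G.tgt → z = u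

end MultiDigraph

namespace MultiDigraph

variable {V : Type*} {ε : Type*}

theorem IsWalk.mem_edges {G : MultiDigraph V ε} {A : Finset ε} {p : List ε} {x y : V}
    (h : G.IsWalk A p x y) : ∀ e ∈ p, e ∈ A := by
  induction p generalizing x with
  | nil => simp
  | cons f p ih =>
    obtain ⟨hf, -, hp⟩ := h
    exact List.forall_mem_cons.2 ⟨hf, ih hp⟩

theorem IsWalk.mono {G : MultiDigraph V ε} {A B : Finset ε} (hAB : A ⊆ B) {p : List ε} {x y : V}
    (h : G.IsWalk A p x y) : G.IsWalk B p x y := by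
  induction p generalizing x with
  | nil => exact h
  | cons f p ih =>
    obtain ⟨hf, hx, hp⟩ := h
    exact ⟨hAB hf, hx, ih hp⟩

/-- A path has a final segment starting at any prescribed vertex on it. -/
theorem IsPath.exists_from_mem {G : MultiDigraph V ε} {A : Finset ε} {p : List ε} {x y z : V}
    (h : G.IsPath A p x y) (hz : z ∈ x :: p.map G.tgt) : ∃ q, G.IsPath A q z y := by
  induction p generalizing x with
  | nil =>
    obtain rfl : z = x := by simpa using hz
    exact ⟨[], h⟩
  | cons f p ih =>
    rcases List.mem_cons.1 hz with rfl | hz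
    · exact ⟨f :: p, h⟩
    · exact ih ⟨h.1.2.2, h.2.of_cons⟩ hz

theorem Reaches.exists_isPath {G : MultiDigraph V ε} {A : Finset ε} {x y : V}
    (h : G.Reaches A x y) : ∃ p, G.IsPath A p x y := by
  induction h using Relation.ReflTransGen.head_induction_on with
  | refl => exact ⟨[], rfl, List.nodup_singleton _⟩
  | @head a c hac _ ih =>
    obtain ⟨f, hf, rfl, rfl⟩ := hac
    obtain ⟨p, hp⟩ := ih
    by_cases ha : G.src f ∈ G.tgt f :: p.map G.tgt
    · exact hp.exists_from_mem ha
    · exact ⟨f :: p, ⟨hf, rfl, hp.1⟩, List.nodup_cons.2 ⟨ha, hp.2⟩⟩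

/-- If `e` is the only edge of `A` entering its head, then any vertex reachable in `A` is
reachable without entering that head, unless the tail of `e` is. -/
theorem Reaches.avoid_or_src [DecidableEq V] {G : MultiDigraph V ε} {A : Finset ε} {e : ε}
    (he : ∀ f ∈ A, G.tgt f = G.tgt e → f = e) {x y : V} (h : G.Reaches A x y) :
    G.Reaches (A.filter fun f => G.tgt f ≠ G.tgt e) x y ∨
      G.Reaches (A.filter fun f => G.tgt f ≠ G.tgt e) x (G.src e) := by
  induction h with
  | refl => exact Or.inl .refl
  | tail _ hstep ih =>
    obtain ⟨f, hf, rfl, rfl⟩ := hstep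
    refine ih.elim (fun ih => ?_) Or.inr
    by_cases hfe : G.tgt f = G.tgt e
    · exact Or.inr (he f hf hfe ▸ ih)
    · exact Or.inl (ih.tail ⟨f, Finset.mem_filter.2 ⟨hf, hfe⟩, rfl, rfl⟩)

/-- In an arborescence, the tail of an edge is reachable without entering the head. -/
theorem IsArbAt.reaches_src [DecidableEq V] {G : MultiDigraph V ε} {A : Finset ε} {r : V}
    (hA : G.IsArbAt A r) {e : ε} (he : e ∈ A) :
    G.Reaches (A.filter fun f => G.tgt f ≠ G.tgt e) r (G.src e) := by
  obtain ⟨-, -, hverts, hr, huniq, hreach⟩ := hA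
  have htgt := (hverts e he).2
  have heq : ∀ f ∈ A, G.tgt f = G.tgt e → f = e := fun f hf hfe =>
    (huniq _ htgt (hr e he)).unique ⟨hf, hfe⟩ ⟨he, rfl⟩
  refine ((hreach _ htgt).avoid_or_src heq).resolve_left fun h => ?_
  rcases Relation.ReflTransGen.cases_tail h with h | ⟨_, _, f, hf, _, hfe⟩
  · exact hr e he h
  · exact (Finset.mem_filter.1 hf).2 hfe

end MultiDigraph

open MvPolynomial

variable {V : Type*} {ε : Type*} [DecidableEq V] [DecidableEq ε]

/-- For `G` rooted at `v`, `u ∈ V`, `D = dom_G(u)` and `A` an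
arborescence of `G` rooted at `v`: every edge of `A` entering `u` has its tail outside
`D`; in particular `A` uses no edge into `u` whose tail lies in `D∖{u}`. -/
theorem statement_19 (G : MultiDigraph V ε) (hwf : G.WellFormed) (hsimple : G.Simple)
    (v : V) (hroot : G.RootedAt v) (u : V) (hu : u ∈ G.verts)
    (A : Finset ε) (hA : G.IsArbAt A v) :
    ∀ e ∈ A, G.tgt e = u → G.src e ∉ G.domSet v u := by
  rintro e he rfl hdom
  simp only [MultiDigraph.domSet, Finset.mem_filter] at hdom
  obtain ⟨p, hp, hnodup⟩ := (hA.reaches_src he).exists_isPath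
  have hmem := hdom.2 p
    ⟨hp.mono ((Finset.filter_subset _ _).trans hA.1), hnodup⟩
  rcases List.mem_cons.1 hmem with h | h
  · exact hA.2.2.2.1 e he h
  · obtain ⟨f, hf, hfe⟩ := List.mem_map.1 h
    exact (Finset.mem_filter.1 (hp.mem_edges f hf)).2 hfe
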